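/- Consider a QVE x = a + b(x,x) with nonnegative bilinear b, a ≥ 0, a + b(e,e) = e, whose minimal nonnegative solution is strictly positive, and suppose R_{ij} = 0 for all i > M and j ≤ M (block upper triangular R). If x = (x1; x2) > 0 (partitioned into its first M and last N−M components) solves the QVE, then the M×M matrix T_{x2} := I_M − P b(·, Q^T x2) P^T − P b(Q^T x2, ·) P^T is nonsingular, x2 solves x2 = a2 + b2(x2,x2), and x1 solves x1 = a_{x2} + b_{x2}(x1,x1). -/

import Mathlib

open Matrix

/-- The projection `P = [I 0]` onto the first `M` of `M + K` coordinates. -/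
def Pmat (M K : ℕ) : Matrix (Fin M) (Fin (M + K)) ℝ :=
  Matrix.of fun i j => if (j : ℕ) = (i : ℕ) then 1 else 0

/-- The projection `Q = [0 I]` onto the last `K` of `M + K` coordinates. -/
def Qmat (M K : ℕ) : Matrix (Fin K) (Fin (M + K)) ℝ :=
  Matrix.of fun i j => if (j : ℕ) = M + (i : ℕ) then 1 else 0

/-- `T_y := I_M - P b(·, Qᵀy) Pᵀ - P b(Qᵀy, ·) Pᵀ`. -/
noncomputable def Tmat (M K : ℕ)
    (b : (Fin (M + K) → ℝ) →ₗ[ℝ] (Fin (M + K) → ℝ) →ₗ[ℝ] (Fin (M + K) → ℝ))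
    (y : Fin K → ℝ) : Matrix (Fin M) (Fin M) ℝ :=
  1 - Pmat M K * LinearMap.toMatrix' (b.flip ((Qmat M K)ᵀ.mulVec y)) * (Pmat M K)ᵀ
    - Pmat M K * LinearMap.toMatrix' (b ((Qmat M K)ᵀ.mulVec y)) * (Pmat M K)ᵀ

/-- `b_2(u,v) := Q b(Qᵀu, Qᵀv)`. -/
def b2 (M K : ℕ)
    (b : (Fin (M + K) → ℝ) →ₗ[ℝ] (Fin (M + K) → ℝ) →ₗ[ℝ] (Fin (M + K) → ℝ))
    (u v : Fin K → ℝ) : Fin K → ℝ :=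
  (Qmat M K).mulVec (b ((Qmat M K)ᵀ.mulVec u) ((Qmat M K)ᵀ.mulVec v))

/-- `a_y := T_y⁻¹ (a_1 + P b(Qᵀy, Qᵀy))` where `a_1 = P a`. -/
noncomputable def aSub (M K : ℕ)
    (b : (Fin (M + K) → ℝ) →ₗ[ℝ] (Fin (M + K) → ℝ) →ₗ[ℝ] (Fin (M + K) → ℝ))
    (a : Fin (M + K) → ℝ) (y : Fin K → ℝ) : Fin M → ℝ :=
  (Tmat M K b y)⁻¹.mulVec
    ((Pmat M K).mulVec a
      + (Pmat M K).mulVec (b ((Qmat M K)ᵀ.mulVec y) ((Qmat M K)ᵀ.mulVec y)))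

/-- `b_y(u,v) := T_y⁻¹ P b(Pᵀu, Pᵀv)`. -/
noncomputable def bSub (M K : ℕ)
    (b : (Fin (M + K) → ℝ) →ₗ[ℝ] (Fin (M + K) → ℝ) →ₗ[ℝ] (Fin (M + K) → ℝ))
    (y : Fin K → ℝ) (u v : Fin M → ℝ) : Fin M → ℝ :=
  (Tmat M K b y)⁻¹.mulVec
    ((Pmat M K).mulVec (b ((Pmat M K)ᵀ.mulVec u) ((Pmat M K)ᵀ.mulVec v)))

section NonnegativeBilinear

variable {ι : Type*} [Fintype ι] [DecidableEq ι]
  {b : (ι → ℝ) →ₗ[ℝ] (ι → ℝ) →ₗ[ℝ] (ι → ℝ)}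

theorem bilin_apply_eq_sum (b : (ι → ℝ) →ₗ[ℝ] (ι → ℝ) →ₗ[ℝ] (ι → ℝ)) (u v : ι → ℝ) (i : ι) :
    b u v i = ∑ j, ∑ k, u j * v k * b (Pi.single j 1) (Pi.single k 1) i := by
  have h : ∀ w : ι → ℝ, w = ∑ j, w j • (Pi.single j 1 : ι → ℝ) := fun w => by
    ext k
    simp [Finset.sum_apply, Pi.single_apply]
  conv_lhs => rw [h u, h v]
  simp only [map_sum, map_smul, LinearMap.sum_apply, LinearMap.smul_apply, Finset.sum_apply,
    Pi.smul_apply, smul_eq_mul, Finset.mul_sum]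
  rw [Finset.sum_comm]
  refine Finset.sum_congr rfl fun j _ => Finset.sum_congr rfl fun k _ => ?_
  ring

theorem bilin_nonneg (hb : ∀ i j k, 0 ≤ b (Pi.single j 1) (Pi.single k 1) i)
    {u v : ι → ℝ} (hu : 0 ≤ u) (hv : 0 ≤ v) : 0 ≤ b u v := fun i => by
  rw [bilin_apply_eq_sum]
  exact Finset.sum_nonneg fun j _ => Finset.sum_nonneg fun k _ =>
    mul_nonneg (mul_nonneg (hu j) (hv k)) (hb i j k)

theorem bilin_mono (hb : ∀ i j k, 0 ≤ b (Pi.single j 1) (Pi.single k 1) i)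
    {u u' v v' : ι → ℝ} (hu : 0 ≤ u) (hv : 0 ≤ v) (huu : u ≤ u') (hvv : v ≤ v') :
    b u v ≤ b u' v' := by
  have h1 := bilin_nonneg hb (sub_nonneg.2 huu) (hv.trans hvv)
  have h2 := bilin_nonneg hb hu (sub_nonneg.2 hvv)
  rw [map_sub, LinearMap.sub_apply, sub_nonneg] at h1
  rw [map_sub, sub_nonneg] at h2
  exact h2.trans h1

theorem abs_bilin_le (hb : ∀ i j k, 0 ≤ b (Pi.single j 1) (Pi.single k 1) i)
    (u v : ι → ℝ) (i : ι) : |b u v i| ≤ b |u| |v| i := by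
  rw [bilin_apply_eq_sum, bilin_apply_eq_sum b |u|]
  refine (Finset.abs_sum_le_sum_abs _ _).trans (Finset.sum_le_sum fun j _ => ?_)
  refine (Finset.abs_sum_le_sum_abs _ _).trans (Finset.sum_le_sum fun k _ => ?_)
  rw [abs_mul, abs_mul, abs_of_nonneg (hb i j k), Pi.abs_apply, Pi.abs_apply]

/-- Vanishing of a nonnegative bilinear form only depends on the supports of its arguments. -/
theorem bilin_apply_eq_zero_of_support
    (hb : ∀ i j k, 0 ≤ b (Pi.single j 1) (Pi.single k 1) i)
    {u u' v v' : ι → ℝ} {i : ι} (hu : 0 ≤ u) (hv : 0 ≤ v) (h : b u v i = 0)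
    (huu : ∀ j, u j = 0 → u' j = 0) (hvv : ∀ j, v j = 0 → v' j = 0) : b u' v' i = 0 := by
  have hnn : ∀ j k, 0 ≤ u j * v k * b (Pi.single j 1) (Pi.single k 1) i := fun j k =>
    mul_nonneg (mul_nonneg (hu j) (hv k)) (hb i j k)
  rw [bilin_apply_eq_sum,
    Finset.sum_eq_zero_iff_of_nonneg fun j _ => Finset.sum_nonneg fun k _ => hnn j k] at h
  rw [bilin_apply_eq_sum]
  refine Finset.sum_eq_zero fun j hj => Finset.sum_eq_zero fun k hk => ?_
  have h1 := (Finset.sum_eq_zero_iff_of_nonneg fun k _ => hnn j k).1 (h j hj) k hk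
  rcases mul_eq_zero.1 h1 with h1 | h1
  · rcases mul_eq_zero.1 h1 with h1 | h1
    · simp [huu j h1]
    · simp [hvv k h1]
  · simp [h1]

/-- A nonnegative supersolution of the QVE dominates a nonnegative solution. -/
theorem exists_solution_le_of_supersolution
    (hb : ∀ i j k, 0 ≤ b (Pi.single j 1) (Pi.single k 1) i)
    {a y : ι → ℝ} (ha : 0 ≤ a) (hy : 0 ≤ y) (hsup : a + b y y ≤ y) :
    ∃ z, 0 ≤ z ∧ z = a + b z z ∧ z ≤ y := by
  let F : (ι → ℝ) → (ι → ℝ) := fun u => a + b u u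
  have hF : Continuous F := by
    refine continuous_pi fun i => ?_
    have h : (fun u => F u i) = fun u : ι → ℝ =>
        a i + ∑ j, ∑ k, u j * u k * b (Pi.single j 1) (Pi.single k 1) i :=
      funext fun u => congrArg (a i + ·) (bilin_apply_eq_sum b u u i)
    rw [h]
    fun_prop
  have hmono : ∀ {u v}, 0 ≤ u → u ≤ v → F u ≤ F v := fun hu huv =>
    add_le_add_right (bilin_mono hb hu hu huv huv) a
  have hrange : ∀ n, 0 ≤ F^[n] 0 ∧ F^[n] 0 ≤ y := by
    intro n
    induction n with
    | zero => exact ⟨le_rfl, hy⟩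
    | succ n ih =>
      rw [Function.iterate_succ_apply']
      exact ⟨add_nonneg ha (bilin_nonneg hb ih.1 ih.1), (hmono ih.1 ih.2).trans hsup⟩
  have hseq : Monotone fun n => F^[n] 0 := by
    refine monotone_nat_of_le_succ fun n => ?_
    induction n with
    | zero => exact (hrange 1).1
    | succ n ih =>
      have h := hmono (hrange n).1 ih
      rwa [← Function.iterate_succ_apply' F n, ← Function.iterate_succ_apply' F (n + 1)] at h
  have hlim : Filter.Tendsto (fun n => F^[n] 0) Filter.atTop
      (nhds fun i => ⨆ n, F^[n] 0 i) := by
    refine tendsto_pi_nhds.2 fun i => ?_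
    refine tendsto_atTop_ciSup (fun m n hmn => hseq hmn i) ⟨y i, ?_⟩
    rintro _ ⟨n, rfl⟩
    exact (hrange n).2 i
  refine ⟨_, ge_of_tendsto' hlim fun n => (hrange n).1, ?_, le_of_tendsto' hlim fun n => (hrange n).2⟩
  exact (isFixedPt_of_tendsto_iterate hlim hF.continuousAt).symm

/-- If the minimal solution is positive, then splitting a positive solution as `x = p + q` makes
`w ↦ b(w, q) + b(q, w)` free of the eigenvalue `1` on the vectors supported in that of `p`. -/
theorem eq_zero_of_fixed_by_linearization
    (hb : ∀ i j k, 0 ≤ b (Pi.single j 1) (Pi.single k 1) i)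
    {a xstar x p q w : ι → ℝ} (ha : 0 ≤ a) (hxstar_pos : ∀ i, 0 < xstar i)
    (hxstar_sol : xstar = a + b xstar xstar)
    (hxstar_min : ∀ z : ι → ℝ, 0 ≤ z → z = a + b z z → xstar ≤ z)
    (hx : ∀ i, 0 < x i) (hsol : x = a + b x x) (hp : 0 ≤ p) (hq : 0 ≤ q) (hpq : x = p + q)
    (hpq0 : ∀ i, p i = 0 ∨ q i = 0) (hwp : ∀ i, p i = 0 → w i = 0)
    (hw : ∀ i, p i ≠ 0 → w i = b w q i + b q w i) : w = 0 := by
  by_contra hw0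
  obtain ⟨i0, hi0⟩ := Function.ne_iff.1 hw0
  have : Nonempty ι := ⟨i0⟩
  obtain ⟨m, hm⟩ := Finite.exists_max fun i => |w i| / x i
  set r := |w m| / x m with hr
  have hrpos : 0 < r := (div_pos (abs_pos.2 hi0) (hx i0)).trans_le (hm i0)
  have hle : |w| ≤ r • p := by
    intro i
    have h := (div_le_iff₀ (hx i)).1 (hm i)
    rcases hpq0 i with hi | hi
    · simp [hwp i hi, hi]
    · simpa [hpq, hi] using h
  set S : Set ι := {i | |w i| = r * x i} with hS
  have hmS : m ∈ S := by simp [hS, hr, (hx m).ne']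
  have hpS : ∀ i ∈ S, p i ≠ 0 := by
    intro i hi h
    have h2 : |w i| = r * x i := hi
    rw [hwp i h, abs_zero] at h2
    exact (mul_pos hrpos (hx i)).ne h2
  have hd : 0 ≤ r • p - |w| := sub_nonneg.2 hle
  have key : ∀ i ∈ S, a i = 0 ∧ b p p i = 0 ∧ b q q i = 0 ∧
      b (r • p - |w|) q i = 0 ∧ b q (r • p - |w|) i = 0 := by
    intro i hi
    have h1 : |w i| = r * x i := hi
    have h2 : |w i| ≤ b |w| q i + b q |w| i := by
      have h3 := abs_bilin_le hb w q i
      have h4 := abs_bilin_le hb q w i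
      rw [abs_of_nonneg hq] at h3 h4
      rw [hw i (hpS i hi)]
      exact (abs_add_le _ _).trans (add_le_add h3 h4)
    have h3 : x i = a i + (b p p i + b q p i + (b p q i + b q q i)) := by
      conv_lhs => rw [hsol, hpq]
      simp only [map_add, LinearMap.add_apply, Pi.add_apply]
    have e1 := bilin_nonneg hb hd hq i
    have e2 := bilin_nonneg hb hq hd i
    have e3 := mul_nonneg hrpos.le (bilin_nonneg hb hp hp i)
    have e4 := mul_nonneg hrpos.le (bilin_nonneg hb hq hq i)
    have e5 := mul_nonneg hrpos.le (ha i)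
    simp only [map_sub, map_smul, LinearMap.sub_apply, LinearMap.smul_apply, Pi.sub_apply,
      Pi.smul_apply, smul_eq_mul, Pi.zero_apply] at e1 e2 e3 e4 e5 ⊢
    rw [h3] at h1
    have z : ∀ {t : ℝ}, r * t = 0 → t = 0 := fun h => (mul_eq_zero.1 h).resolve_left hrpos.ne'
    refine ⟨z ?_, z ?_, z ?_, ?_, ?_⟩ <;> linarith
  classical
  set y : ι → ℝ := fun i => if i ∈ S then 0 else xstar i with hydef
  have hy : 0 ≤ y := fun i => by
    simp only [hydef, Pi.zero_apply]; split_ifs <;> simp [(hxstar_pos i).le]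
  have hyle : y ≤ xstar := fun i => by
    simp only [hydef]; split_ifs <;> simp [(hxstar_pos i).le]
  have hsup : a + b y y ≤ y := by
    intro i
    by_cases hi : i ∈ S
    · obtain ⟨h1, h2, h3, h4, h5⟩ := key i hi
      set y1 : ι → ℝ := fun j => if p j = 0 then 0 else y j with hy1
      set y2 : ι → ℝ := fun j => if q j = 0 then 0 else y j with hy2
      have hyy : y = y1 + y2 := by
        ext j
        have hxj := (hx j).ne'
        rw [hpq, Pi.add_apply] at hxj
        rw [Pi.add_apply, hy1, hy2]
        rcases hpq0 j with h | h
        · have h' : q j ≠ 0 := by simpa [h] using hxj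
          simp only [h, h', if_true, if_false, zero_add]
        · have h' : p j ≠ 0 := by simpa [h] using hxj
          simp only [h, h', if_true, if_false, add_zero]
      have s1 : ∀ j, p j = 0 → y1 j = 0 := fun j h => by simp [hy1, h]
      have s2 : ∀ j, q j = 0 → y2 j = 0 := fun j h => by simp [hy2, h]
      have s3 : ∀ j, (r • p - |w|) j = 0 → y1 j = 0 := fun j h => by
        by_cases hj : p j = 0
        · exact s1 j hj
        · have hjS : j ∈ S := by
            have hqj := (hpq0 j).resolve_left hj
            have h' : r * p j - |w j| = 0 := h
            simp only [hS, Set.mem_ofPred_eq, hpq, Pi.add_apply, hqj, add_zero]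
            linarith
          simp [hy1, hydef, hjS]
      have hyi : y i = 0 := if_pos hi
      have hbi : b y y i = 0 := by
        rw [hyy]
        simp only [map_add, LinearMap.add_apply, Pi.add_apply]
        rw [bilin_apply_eq_zero_of_support hb hp hp h2 s1 s1,
          bilin_apply_eq_zero_of_support hb hq hq h3 s2 s2,
          bilin_apply_eq_zero_of_support hb hd hq h4 s3 s2,
          bilin_apply_eq_zero_of_support hb hq hd h5 s2 s3]
        simp
      simp [h1, hyi, hbi]
    · have hyi : y i = xstar i := if_neg hi
      rw [hyi]
      conv_rhs => rw [hxstar_sol]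
      exact add_le_add_right (bilin_mono hb hy hy hyle hyle i) (a i)
  obtain ⟨z, hz, hzs, hzy⟩ := exists_solution_le_of_supersolution hb ha hy hsup
  have h := (hxstar_min z hz hzs m).trans (hzy m)
  have hym : y m = 0 := if_pos hmS
  rw [hym] at h
  exact (hxstar_pos m).not_ge h

end NonnegativeBilinear

section BlockProjections

variable {M K : ℕ}

theorem Pmat_mulVec (u : Fin (M + K) → ℝ) (i : Fin M) :
    (Pmat M K).mulVec u i = u (Fin.castAdd K i) := by
  simp only [Pmat, mulVec, dotProduct, Matrix.of_apply, ite_mul, one_mul, zero_mul]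
  rw [Finset.sum_eq_single (Fin.castAdd K i)] <;> simp +contextual [Fin.ext_iff]

theorem Qmat_mulVec (u : Fin (M + K) → ℝ) (i : Fin K) :
    (Qmat M K).mulVec u i = u (Fin.natAdd M i) := by
  simp only [Qmat, mulVec, dotProduct, Matrix.of_apply, ite_mul, one_mul, zero_mul]
  rw [Finset.sum_eq_single (Fin.natAdd M i)] <;> simp +contextual [Fin.ext_iff]

theorem Pmat_transpose_mulVec (v : Fin M → ℝ) :
    (Pmat M K)ᵀ.mulVec v = Fin.append v (0 : Fin K → ℝ) := by
  ext j
  refine Fin.addCases (fun i => ?_) (fun i => ?_) j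
  · simp [Pmat, mulVec, dotProduct, Fin.val_inj]
  · have h : ∀ k : Fin M, M + (i : ℕ) ≠ k := fun k => by lia
    simp [Pmat, mulVec, dotProduct, h]

theorem Qmat_transpose_mulVec (v : Fin K → ℝ) :
    (Qmat M K)ᵀ.mulVec v = Fin.append (0 : Fin M → ℝ) v := by
  ext j
  refine Fin.addCases (fun i => ?_) (fun i => ?_) j
  · have h : ∀ k : Fin K, (i : ℕ) ≠ M + k := fun k => by lia
    simp [Qmat, mulVec, dotProduct, h]
  · simp [Qmat, mulVec, dotProduct, Fin.val_inj]

theorem Tmat_mulVec (b : (Fin (M + K) → ℝ) →ₗ[ℝ] (Fin (M + K) → ℝ) →ₗ[ℝ] (Fin (M + K) → ℝ))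
    (y : Fin K → ℝ) (v : Fin M → ℝ) :
    (Tmat M K b y).mulVec v = v
      - (Pmat M K).mulVec (b ((Pmat M K)ᵀ.mulVec v) ((Qmat M K)ᵀ.mulVec y))
      - (Pmat M K).mulVec (b ((Qmat M K)ᵀ.mulVec y) ((Pmat M K)ᵀ.mulVec v)) := by
  simp only [Tmat, sub_mulVec, one_mulVec, ← mulVec_mulVec, LinearMap.toMatrix'_mulVec,
    LinearMap.flip_apply]

end BlockProjections

/-- if `x > 0` solves the QVE (with block upper triangular `R` and
strictly positive minimal solution), then `T_{x₂}` is nonsingular and the two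
block components `x₂`, `x₁` solve the two reduced QVEs. -/
theorem stmt_5 {M K : ℕ} (hM : 1 ≤ M) (hK : 1 ≤ K)
    (b : (Fin (M + K) → ℝ) →ₗ[ℝ] (Fin (M + K) → ℝ) →ₗ[ℝ] (Fin (M + K) → ℝ))
    (hb : ∀ i j k : Fin (M + K), 0 ≤ b (Pi.single j 1) (Pi.single k 1) i)
    (a : Fin (M + K) → ℝ) (ha : 0 ≤ a)
    (he : a + b (fun _ => 1) (fun _ => 1) = fun _ => 1)
    (xstar : Fin (M + K) → ℝ) (hxstar_pos : ∀ i, 0 < xstar i)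
    (hxstar_sol : xstar = a + b xstar xstar)
    (hxstar_min : ∀ xbar : Fin (M + K) → ℝ, 0 ≤ xbar → xbar = a + b xbar xbar → xstar ≤ xbar)
    (hR : ∀ i j : Fin (M + K), M ≤ (i : ℕ) → (j : ℕ) < M →
      ∑ k, (b (Pi.single j 1) (Pi.single k 1) i + b (Pi.single k 1) (Pi.single j 1) i) = 0)
    (x : Fin (M + K) → ℝ) (hx : ∀ i, 0 < x i) (hsol : x = a + b x x)
    (x1 : Fin M → ℝ) (hx1 : x1 = (Pmat M K).mulVec x)
    (x2 : Fin K → ℝ) (hx2 : x2 = (Qmat M K).mulVec x) :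
    IsUnit (Tmat M K b x2)
    ∧ x2 = (Qmat M K).mulVec a + b2 M K b x2 x2
    ∧ x1 = aSub M K b a x2 + bSub M K b x2 x1 x1 := by
  have hcoef : ∀ i j k : Fin (M + K), M ≤ (i : ℕ) → (j : ℕ) < M →
      b (Pi.single j 1) (Pi.single k 1) i = 0 ∧ b (Pi.single k 1) (Pi.single j 1) i = 0 := by
    intro i j k hi hj
    have h := (Finset.sum_eq_zero_iff_of_nonneg fun k _ => add_nonneg (hb i j k) (hb i k j)).1
      (hR i j hi hj) k (Finset.mem_univ k)
    exact (add_eq_zero_iff_of_nonneg (hb i j k) (hb i k j)).1 h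
  set p := (Pmat M K)ᵀ.mulVec x1 with hp
  set q := (Qmat M K)ᵀ.mulVec x2 with hq
  have hpl : ∀ i, p (Fin.castAdd K i) = x (Fin.castAdd K i) := fun i => by
    rw [hp, Pmat_transpose_mulVec, Fin.append_left, hx1, Pmat_mulVec]
  have hpr : ∀ i, p (Fin.natAdd M i) = 0 := fun i => by
    rw [hp, Pmat_transpose_mulVec, Fin.append_right, Pi.zero_apply]
  have hql : ∀ i, q (Fin.castAdd K i) = 0 := fun i => by
    rw [hq, Qmat_transpose_mulVec, Fin.append_left, Pi.zero_apply]
  have hqr : ∀ i, q (Fin.natAdd M i) = x (Fin.natAdd M i) := fun i => by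
    rw [hq, Qmat_transpose_mulVec, Fin.append_right, hx2, Qmat_mulVec]
  have hpq : x = p + q := by
    ext j
    refine Fin.addCases (fun i => ?_) (fun i => ?_) j
    · simp [hpl, hql]
    · simp [hpr, hqr]
  have hbx : b x x = b p p + b q p + (b p q + b q q) := by
    rw [hpq]; simp only [map_add, LinearMap.add_apply]
  have hunit : IsUnit (Tmat M K b x2) := by
    rw [isUnit_iff_isUnit_det, isUnit_iff_ne_zero]
    intro hdet
    obtain ⟨v, hv0, hv⟩ := exists_mulVec_eq_zero_iff.2 hdet
    refine hv0 ?_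
    have hw : (Pmat M K)ᵀ.mulVec v = 0 := by
      refine eq_zero_of_fixed_by_linearization (p := p) (q := q) hb ha hxstar_pos hxstar_sol
        hxstar_min hx hsol ?_ ?_ hpq ?_ ?_ ?_
      · refine fun j => Fin.addCases (fun i => ?_) (fun i => ?_) j
        · simp [hpl, (hx _).le]
        · simp [hpr]
      · refine fun j => Fin.addCases (fun i => ?_) (fun i => ?_) j
        · simp [hql]
        · simp [hqr, (hx _).le]
      · exact fun j => Fin.addCases (fun i => .inr (hql i)) (fun i => .inl (hpr i)) j
      · refine fun j => Fin.addCases (fun i h => ?_) (fun i _ => ?_) j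
        · exact absurd ((hpl i).symm.trans h) (hx _).ne'
        · rw [Pmat_transpose_mulVec, Fin.append_right, Pi.zero_apply]
      · refine fun j => Fin.addCases (fun i _ => ?_) (fun i h => absurd (hpr i) h) j
        have h := congrFun hv i
        rw [Tmat_mulVec] at h
        simp only [Pi.sub_apply, Pmat_mulVec, Pi.zero_apply, ← hq] at h
        have h2 : (Pmat M K)ᵀ.mulVec v (Fin.castAdd K i) = v i := by
          rw [Pmat_transpose_mulVec, Fin.append_left]
        rw [h2]
        linarith
    ext i
    have h := congrFun hw (Fin.castAdd K i)
    rwa [Pmat_transpose_mulVec, Fin.append_left] at h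
  refine ⟨hunit, ?_, ?_⟩
  · ext i
    have hi : M ≤ (Fin.natAdd M i : ℕ) := by simp
    have hzero : ∀ u : Fin (M + K) → ℝ,
        b p u (Fin.natAdd M i) = 0 ∧ b u p (Fin.natAdd M i) = 0 := by
      intro u
      rw [bilin_apply_eq_sum, bilin_apply_eq_sum b u]
      constructor
      · refine Finset.sum_eq_zero fun j _ => Finset.sum_eq_zero fun k _ => ?_
        refine Fin.addCases (fun l => ?_) (fun l => ?_) j
        · rw [(hcoef _ _ k hi (by simp)).1, mul_zero]
        · simp [hpr]
      · refine Finset.sum_eq_zero fun j _ => Finset.sum_eq_zero fun k _ => ?_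
        refine Fin.addCases (fun l => ?_) (fun l => ?_) k
        · rw [(hcoef _ _ j hi (by simp)).2, mul_zero]
        · simp [hpr]
    have h := congrFun hsol (Fin.natAdd M i)
    rw [hbx] at h
    simp only [Pi.add_apply, (hzero _).1, (hzero _).2, zero_add] at h
    rw [b2, ← hq]
    simp only [Pi.add_apply, Qmat_mulVec]
    rw [← h, hx2, Qmat_mulVec]
  · have hT : (Tmat M K b x2).mulVec x1 =
        ((Pmat M K).mulVec a + (Pmat M K).mulVec (b q q)) + (Pmat M K).mulVec (b p p) := by
      ext i
      rw [Tmat_mulVec, ← hp, ← hq]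
      have h := congrFun hsol (Fin.castAdd K i)
      rw [hbx] at h
      simp only [Pi.add_apply, Pi.sub_apply, Pmat_mulVec, hx1] at h ⊢
      linarith
    rw [aSub, bSub, ← hp, ← hq, ← mulVec_add, ← hT, mulVec_mulVec,
      nonsing_inv_mul _ ((isUnit_iff_isUnit_det _).1 hunit), one_mulVec]
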